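/- Let n > 3 be odd and m admissible. If H is a subloop of L_n(m) of order t + 1 with t ≥ 1 (so H contains e and at least one non-identity element and is closed under the product), then t divides n. Conversely, for every divisor k of n, L_n(m) contains a subloop of order k + 1. Hence L_n(m) contains a subloop of order k + 1 if and only if k divides n. -/

import Mathlib

/-- `m` is admissible for `n`: `0 < m < n`, `gcd(m, n) = 1` and `gcd(m - 1, n) = 1`. -/
def LAdmissible (n m : ℕ) : Prop :=
  0 < m ∧ m < n ∧ Nat.gcd m n = 1 ∧ Nat.gcd (m - 1) n = 1

/-- The product of the loop `L_n(m)`: the carrier is `Option (ZMod n)`, with `none`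
playing the role of the identity `e` and `some i` the element `i ∈ Z_n`.
`e·x = x·e = x`, `i·i = e`, and for `i ≠ j`, `i·j = m·j - (m-1)·i (mod n)`. -/
def lmul (n m : ℕ) : Option (ZMod n) → Option (ZMod n) → Option (ZMod n)
  | none, x => x
  | some i, none => some i
  | some i, some j =>
      if i = j then none
      else some ((m : ZMod n) * j - ((m : ZMod n) - 1) * i)
/-- In a finite ring, a set closed under left multiplication by a unit is mapped onto itself. -/
lemma exists_mul_eq_of_isUnit {R : Type*} [CommRing R] [Finite R] {u : R} (hu : IsUnit u)
    {S : Set R} (hS : ∀ x ∈ S, u * x ∈ S) {y : R} (hy : y ∈ S) : ∃ x ∈ S, u * x = y := by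
  have hinj : Function.Injective (fun x : R => u * x) := hu.mul_right_injective
  have himg : (fun x : R => u * x) '' S = S := by
    refine Set.eq_of_subset_of_ncard_le ?_ ?_ S.toFinite
    · rintro _ ⟨x, hx, rfl⟩
      exact hS x hx
    · rw [Set.ncard_image_of_injective S hinj]
  rw [← himg] at hy
  exact hy

/-- In a finite ring, a set containing `0` and closed under `(x, y) ↦ u * y + (1 - u) * x`, where
`u` and `1 - u` are units, is an additive subgroup. -/
lemma exists_addSubgroup_of_affine_closed {R : Type*} [CommRing R] [Finite R] {u : R}
    (hu : IsUnit u) (hu' : IsUnit (1 - u)) {S : Set R} (h0 : 0 ∈ S)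
    (hS : ∀ x ∈ S, ∀ y ∈ S, u * y + (1 - u) * x ∈ S) : ∃ G : AddSubgroup R, (G : Set R) = S := by
  have hmul : ∀ x ∈ S, u * x ∈ S := fun x hx => by simpa using hS 0 h0 x hx
  have hmul' : ∀ x ∈ S, (1 - u) * x ∈ S := fun x hx => by simpa using hS x hx 0 h0
  have hadd : ∀ {x y : R}, x ∈ S → y ∈ S → x + y ∈ S := by
    intro x y hx hy
    obtain ⟨x', hx', rfl⟩ := exists_mul_eq_of_isUnit hu hmul hx
    obtain ⟨y', hy', rfl⟩ := exists_mul_eq_of_isUnit hu' hmul' hy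
    exact hS y' hy' x' hx'
  let M : AddSubmonoid R := { carrier := S, zero_mem' := h0, add_mem' := hadd }
  refine ⟨{ M with neg_mem' := ?_ }, rfl⟩
  intro x hx
  have hcard : 0 < Nat.card R := Nat.card_pos
  have hneg : -x = (Nat.card R - 1) • x := by
    have hsum : (Nat.card R - 1) • x + x = 0 := by
      rw [← succ_nsmul, Nat.sub_add_cancel hcard, card_nsmul_eq_zero']
    exact (eq_neg_of_add_eq_zero_left hsum).symm
  rw [hneg]
  exact M.nsmul_mem hx _

/-- In a finite ring, the size of a nonempty set closed under `(x, y) ↦ u * y + (1 - u) * x`, where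
`u` and `1 - u` are units, divides the size of the ring. -/
lemma ncard_dvd_card_of_affine_closed {R : Type*} [CommRing R] [Finite R] {u : R}
    (hu : IsUnit u) (hu' : IsUnit (1 - u)) {S : Set R} (hne : S.Nonempty)
    (hS : ∀ x ∈ S, ∀ y ∈ S, u * y + (1 - u) * x ∈ S) : S.ncard ∣ Nat.card R := by
  obtain ⟨a, ha⟩ := hne
  obtain ⟨G, hG⟩ := exists_addSubgroup_of_affine_closed (S := (fun x => x - a) '' S) hu hu'
    ⟨a, ha, sub_self a⟩ (by
      rintro _ ⟨x, hx, rfl⟩ _ ⟨y, hy, rfl⟩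
      exact ⟨_, hS x hx y hy, by ring⟩)
  rw [← Set.ncard_image_of_injective S (sub_left_injective (b := a)), ← hG]
  exact G.card_addSubgroup_dvd_card

/-- Adjoining `none` to a finite subset of `α` increases its size by one. -/
lemma ncard_insert_none_image_some {α : Type*} [Finite α] (S : Set α) :
    (insert none (some '' S)).ncard = S.ncard + 1 := by
  rw [Set.ncard_insert_of_notMem (by simp),
    Set.ncard_image_of_injective S (Option.some_injective α)]

lemma LAdmissible.isUnit {n m : ℕ} (hm : LAdmissible n m) : IsUnit (m : ZMod n) :=
  (ZMod.isUnit_iff_coprime m n).2 hm.2.2.1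

lemma LAdmissible.isUnit_one_sub {n m : ℕ} (hm : LAdmissible n m) :
    IsUnit (1 - (m : ZMod n)) := by
  have h := (ZMod.isUnit_iff_coprime (m - 1) n).2 hm.2.2.2
  rw [Nat.cast_sub hm.1, Nat.cast_one] at h
  simpa using h.neg

/-- The order of a nontrivial subloop of `L_n(m)` is one more than a divisor of `n`. -/
lemma dvd_of_subloop {n m : ℕ} [NeZero n] (hm : LAdmissible n m) {H : Set (Option (ZMod n))}
    (he : none ∈ H) (hH : ∀ x ∈ H, ∀ y ∈ H, lmul n m x y ∈ H) {t : ℕ} (ht : 1 ≤ t)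
    (hcard : H.ncard = t + 1) : t ∣ n := by
  have hins : insert none (some '' (some ⁻¹' H)) = H := by
    ext x
    cases x <;> simp [he]
  have hpre : (some ⁻¹' H).ncard = t := by
    have h := ncard_insert_none_image_some (some ⁻¹' H)
    rw [hins] at h
    omega
  have hdvd := ncard_dvd_card_of_affine_closed hm.isUnit hm.isUnit_one_sub
    (S := some ⁻¹' H) (Set.nonempty_of_ncard_ne_zero (by omega)) (by
      intro x hx y hy
      by_cases hxy : x = y
      · subst hxy
        convert hx using 1
        ring
      · have h := hH _ hx _ hy
        simp only [lmul, if_neg hxy] at h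
        rw [Set.mem_preimage]
        convert h using 2
        ring)
  rwa [hpre, Nat.card_zmod] at hdvd

/-- An additive subgroup of `ZMod n` together with the identity is a subloop of `L_n(m)`. -/
lemma lmul_mem_insert_none {n m : ℕ} (G : AddSubgroup (ZMod n)) :
    ∀ x ∈ insert none (some '' (G : Set (ZMod n))),
      ∀ y ∈ insert none (some '' (G : Set (ZMod n))),
        lmul n m x y ∈ insert none (some '' (G : Set (ZMod n))) := by
  rintro _ (rfl | ⟨x, hx, rfl⟩) _ (rfl | ⟨y, hy, rfl⟩)
  · exact Or.inl rfl
  · exact Or.inr ⟨y, hy, rfl⟩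
  · exact Or.inr ⟨x, hx, rfl⟩
  · by_cases hxy : x = y
    · simp [lmul, hxy]
    · simp only [lmul, if_neg hxy]
      refine Or.inr ⟨_, ?_, rfl⟩
      have h := G.sub_mem (G.nsmul_mem hy m) (G.sub_mem (G.nsmul_mem hx m) hx)
      simpa [nsmul_eq_mul, sub_mul] using h

/-- For every divisor `k` of `n`, the loop `L_n(m)` has a subloop of order `k + 1`. -/
lemma exists_subloop_of_dvd {n m k : ℕ} [NeZero n] (hk : k ∣ n) :
    ∃ H : Set (Option (ZMod n)),
      none ∈ H ∧ (∀ x ∈ H, ∀ y ∈ H, lmul n m x y ∈ H) ∧ H.ncard = k + 1 := by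
  obtain ⟨d, hd⟩ := hk
  have hn : n ≠ 0 := NeZero.ne n
  have hd0 : 0 < d := Nat.pos_of_ne_zero (by rintro rfl; simp_all)
  refine ⟨insert none (some '' (AddSubgroup.zmultiples (d : ZMod n) : Set (ZMod n))),
    Or.inl rfl, lmul_mem_insert_none _, ?_⟩
  rw [ncard_insert_none_image_some]
  change Nat.card (AddSubgroup.zmultiples (d : ZMod n)) + 1 = k + 1
  rw [Nat.card_zmultiples, ZMod.addOrderOf_coe d hn,
    Nat.gcd_eq_right (Dvd.intro_left k hd.symm), Nat.div_eq_of_eq_mul_left hd0 hd]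

/-- If `H` is a subloop of `L_n(m)` (a subset containing `e`, closed under the
product) of order `t + 1` with `t ≥ 1`, then `t ∣ n`; conversely, for every
divisor `k` of `n` there is a subloop of order `k + 1`. Hence `L_n(m)` has a
subloop of order `k + 1` iff `k ∣ n`. -/
theorem stmt8 (n m : ℕ) (hn : 3 < n) (hodd : Odd n) (hm : LAdmissible n m) :
    (∀ H : Set (Option (ZMod n)), none ∈ H →
        (∀ x ∈ H, ∀ y ∈ H, lmul n m x y ∈ H) →
        ∀ t : ℕ, 1 ≤ t → H.ncard = t + 1 → t ∣ n)
      ∧ (∀ k : ℕ, k ∣ n → ∃ H : Set (Option (ZMod n)),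
          none ∈ H ∧ (∀ x ∈ H, ∀ y ∈ H, lmul n m x y ∈ H) ∧ H.ncard = k + 1)
      ∧ (∀ k : ℕ, 1 ≤ k →
          ((∃ H : Set (Option (ZMod n)),
              none ∈ H ∧ (∀ x ∈ H, ∀ y ∈ H, lmul n m x y ∈ H) ∧ H.ncard = k + 1)
            ↔ k ∣ n)) := by
  have : NeZero n := ⟨by omega⟩
  exact ⟨fun _ he hH _ ht hcard => dvd_of_subloop hm he hH ht hcard,
    fun _ hk => exists_subloop_of_dvd hk,
    fun _ hk => ⟨fun ⟨_, he, hH, hcard⟩ => dvd_of_subloop hm he hH hk hcard,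
      exists_subloop_of_dvd⟩⟩
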